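/- arXiv:1611.05982 — 5 statements merged into one kernel-verified Lean document; each statement's English description precedes it below -/
import Mathlib

section
/- For all integers i, j, k, the coset (i/2)α¹ + (j/2)α² + (k/2)α³ + ℤ³ of ℤ³ in ℚ³ is equal to the union over m ∈ {0,1,2} of the cosets ((i+j+k+2m)/6)·β₁ + ((2i−j−k+4m)·β₂ + (i+j−2k+2m)·β₃)/6 + N, and these three cosets of N are pairwise disjoint. -/
/-- `ℚ³`, the ambient rational space. -/
abbrev Q3 : Type := Fin 3 → ℚ

/-- The symmetric bilinear form `B(x,y) = 2(x₁y₁ + x₂y₂ + x₃y₃)`. -/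
def Bf (x y : Q3) : ℚ := 2 * (x 0 * y 0 + x 1 * y 1 + x 2 * y 2)

/-- The standard basis vector `α¹`. -/
def a1 : Q3 := ![1, 0, 0]
/-- The standard basis vector `α²`. -/
def a2 : Q3 := ![0, 1, 0]
/-- The standard basis vector `α³`. -/
def a3 : Q3 := ![0, 0, 1]
/-- `β₁ = α¹ + α² + α³`. -/
def b1 : Q3 := ![1, 1, 1]
/-- `β₂ = α¹ − α²`. -/
def b2 : Q3 := ![1, -1, 0]
/-- `β₃ = α² − α³`. -/
def b3 : Q3 := ![0, 1, -1]
/-- `β₀ = −(β₂ + β₃)`. -/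
def b0 : Q3 := ![-1, 0, 1]

/-- `ℤ³ ⊆ ℚ³`, the subgroup of integer vectors. -/
def Z3 : AddSubgroup Q3 where
  carrier := {x | ∀ i, ∃ n : ℤ, x i = n}
  zero_mem' := fun i => ⟨0, by simp⟩
  add_mem' := by
    rintro x y hx hy i
    obtain ⟨a, ha⟩ := hx i
    obtain ⟨b, hb⟩ := hy i
    exact ⟨a + b, by rw [Pi.add_apply, ha, hb]; push_cast; ring⟩
  neg_mem' := by
    rintro x hx i
    obtain ⟨a, ha⟩ := hx i
    exact ⟨-a, by rw [Pi.neg_apply, ha]; push_cast; ring⟩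

/-- The lattice `L = ℤβ₂ + ℤβ₃ ≅ √2·A₂`. -/
def L : AddSubgroup Q3 := AddSubgroup.closure {b2, b3}

/-- The lattice `N = ℤβ₁ + L`. -/
def N : AddSubgroup Q3 := AddSubgroup.closure {b1, b2, b3}

/-- The coset representative
`((i+j+k+2m)/6)·β₁ + ((2i−j−k+4m)·β₂ + (i+j−2k+2m)·β₃)/6` for `m ∈ {0,1,2}`. -/
def w (i j k : ℤ) (m : Fin 3) : Q3 :=
  (((i + j + k + 2 * (m : ℤ) : ℤ) : ℚ) / 6) • b1 +
    ((1 : ℚ) / 6) • (((2 * i - j - k + 4 * (m : ℤ) : ℤ) : ℚ) • b2 +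
      ((i + j - 2 * k + 2 * (m : ℤ) : ℤ) : ℚ) • b3)

/-- Coordinates of the representative. -/
theorem w_eq (i j k : ℤ) (m : Fin 3) :
    w i j k m = ![(i : ℚ) / 2 + ((m : ℤ) : ℚ), (j : ℚ) / 2, (k : ℚ) / 2] := by
  ext t
  fin_cases t <;> simp [w, b1, b2, b3] <;> ring

/-- `N` consists of integer vectors whose coordinate sum is divisible by three. -/
theorem mem_N_iff (x : Q3) :
    x ∈ N ↔ ∃ a b c : ℤ, x 0 = a ∧ x 1 = b ∧ x 2 = c ∧ (3 : ℤ) ∣ a + b + c := by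
  constructor
  · intro h
    unfold N at h
    induction h using AddSubgroup.closure_induction with
    | mem x hx =>
      rcases hx with rfl | rfl | rfl
      · exact ⟨1, 1, 1, by simp [b1], by simp [b1], by simp [b1], by norm_num⟩
      · exact ⟨1, -1, 0, by simp [b2], by simp [b2], by simp [b2], by norm_num⟩
      · exact ⟨0, 1, -1, by simp [b3], by simp [b3], by simp [b3], by norm_num⟩
    | zero => exact ⟨0, 0, 0, by simp, by simp, by simp, by norm_num⟩
    | add x y _ _ hx hy =>
      obtain ⟨a, b, c, h0, h1, h2, h3⟩ := hx
      obtain ⟨a', b', c', h0', h1', h2', h3'⟩ := hy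
      exact ⟨a + a', b + b', c + c', by simp [h0, h0'], by simp [h1, h1'],
        by simp [h2, h2'], by omega⟩
    | neg x _ hx =>
      obtain ⟨a, b, c, h0, h1, h2, h3⟩ := hx
      exact ⟨-a, -b, -c, by simp [h0], by simp [h1], by simp [h2], by omega⟩
  · rintro ⟨a, b, c, h0, h1, h2, t, ht⟩
    have hx : x = t • b1 + (a - t) • b2 + (t - c) • b3 := by
      have hb : (b : ℚ) = 3 * t - a - c := by
        have : b = 3 * t - a - c := by omega
        rw [this]; push_cast; ring
      ext s
      fin_cases s
      · simp [b1, b2, b3, h0]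
      · simp [b1, b2, b3, h1, hb]; ring
      · simp [b1, b2, b3, h2]
    rw [hx]
    unfold N
    refine add_mem (add_mem ?_ ?_) ?_ <;>
      exact zsmul_mem (AddSubgroup.subset_closure (by simp)) _

/-- Membership in a coset of `N`. -/
theorem mem_coset_iff (i j k : ℤ) (m : Fin 3) (y : Q3) :
    y - w i j k m ∈ N ↔ ∃ a b c : ℤ, y 0 = i / 2 + a ∧ y 1 = j / 2 + b ∧ y 2 = k / 2 + c ∧
      (3 : ℤ) ∣ a + b + c - (m : ℤ) := by
  rw [mem_N_iff, w_eq]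
  constructor
  · rintro ⟨a, b, c, h0, h1, h2, h3⟩
    simp at h0 h1 h2
    exact ⟨a + (m : ℤ), b, c, by push_cast; linarith, by linarith, by linarith, by omega⟩
  · rintro ⟨a, b, c, h0, h1, h2, h3⟩
    refine ⟨a - (m : ℤ), b, c, ?_, ?_, ?_, by omega⟩
    · simp [h0]
    · simp [h1]
    · simp [h2]

/-- Membership in a coset of `Z3`. -/
theorem mem_Z3_coset_iff (i j k : ℤ) (y : Q3) :
    y - (((i : ℚ) / 2) • a1 + ((j : ℚ) / 2) • a2 + ((k : ℚ) / 2) • a3) ∈ Z3 ↔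
      ∃ a b c : ℤ, y 0 = i / 2 + a ∧ y 1 = j / 2 + b ∧ y 2 = k / 2 + c := by
  have hv : ((i : ℚ) / 2) • a1 + ((j : ℚ) / 2) • a2 + ((k : ℚ) / 2) • a3
      = ![(i : ℚ) / 2, (j : ℚ) / 2, (k : ℚ) / 2] := by
    ext t
    fin_cases t <;> simp [a1, a2, a3]
  rw [hv]
  constructor
  · intro h
    obtain ⟨a, ha⟩ := h 0
    obtain ⟨b, hb⟩ := h 1
    obtain ⟨c, hc⟩ := h 2
    simp at ha hb hc
    exact ⟨a, b, c, by linarith, by linarith, by linarith⟩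
  · rintro ⟨a, b, c, h0, h1, h2⟩ t
    fin_cases t
    · exact ⟨a, by simp [h0]⟩
    · exact ⟨b, by simp [h1]⟩
    · exact ⟨c, by simp [h2]⟩

/-- For all integers `i, j, k`, the coset `(i/2)α¹ + (j/2)α² + (k/2)α³ + ℤ³` of `ℤ³` in `ℚ³`
equals the union over `m ∈ {0,1,2}` of the cosets
`((i+j+k+2m)/6)·β₁ + ((2i−j−k+4m)·β₂ + (i+j−2k+2m)·β₃)/6 + N`, and these three cosets of `N`
are pairwise disjoint. -/
theorem half_integer_coset_decomposition :
    ∀ i j k : ℤ,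
      ({y : Q3 | y - (((i : ℚ) / 2) • a1 + ((j : ℚ) / 2) • a2 + ((k : ℚ) / 2) • a3) ∈ Z3}
          = ⋃ m : Fin 3, {y : Q3 | y - w i j k m ∈ N}) ∧
      (∀ m m' : Fin 3, m ≠ m' →
        Disjoint {y : Q3 | y - w i j k m ∈ N} {y : Q3 | y - w i j k m' ∈ N}) := by
  intro i j k
  constructor
  · ext y
    simp only [Set.mem_iUnion, Set.mem_setOf_eq, mem_coset_iff, mem_Z3_coset_iff]
    constructor
    · rintro ⟨a, b, c, h0, h1, h2⟩
      refine ⟨⟨((a + b + c) % 3).toNat, by omega⟩, a, b, c, h0, h1, h2, ?_⟩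
      simp only []
      omega
    · rintro ⟨m, a, b, c, h0, h1, h2, -⟩
      exact ⟨a, b, c, h0, h1, h2⟩
  · intro m m' hm
    rw [Set.disjoint_left]
    intro y hy hy'
    rw [Set.mem_setOf_eq, mem_coset_iff] at hy hy'
    obtain ⟨a, b, c, h0, h1, h2, h3⟩ := hy
    obtain ⟨a', b', c', h0', h1', h2', h3'⟩ := hy'
    have e0 : a = a' := by
      have : (a : ℚ) = a' := by linarith
      exact_mod_cast this
    have e1 : b = b' := by
      have : (b : ℚ) = b' := by linarith
      exact_mod_cast this
    have e2 : c = c' := by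
      have : (c : ℚ) = c' := by linarith
      exact_mod_cast this
    subst e0 e1 e2
    apply hm
    have := m.isLt
    have := m'.isLt
    apply Fin.ext
    omega
end

section
/- The multiplication on R is associative and M̃₀[0] is a two-sided multiplicative identity; hence R is a commutative associative unital ring (the fusion ring of the ℤ₃-permutation orbifold of the rank-one lattice vertex operator algebra V_{ℤα} with ⟨α,α⟩ = 2). -/
open scoped BigOperators

inductive B20 : Type
  | Mt : ZMod 2 → ZMod 3 → B20
  | M : ZMod 2 → B20
  | Mh : Fin 2 → ZMod 2 → ZMod 3 → B20
  deriving DecidableEq, Fintype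

/-- The basis element of the fusion ring corresponding to an irreducible module. -/
def e (z : B20) : B20 → ℤ := fun w => if w = z then 1 else 0

/-- The value (1 or 2) of the twist parameter `k ∈ {1,2}` as an element of `ZMod 3`. -/
def kv (k : Fin 2) : ZMod 3 := ((k : ℕ) + 1 : ℕ)

/-- The fusion product of two basis elements, as an element of the free `ℤ`-module. -/
def bprod : B20 → B20 → B20 → ℤ
  | .Mt i ε, .Mt j ε₁ => e (.Mt (i + j) (ε + ε₁))
  | .Mt i _, .M j => e (.M (i + j))
  | .M i, .Mt j _ => e (.M (i + j))
  | .M i, .M j => e (.Mt (i + j) 0) + e (.Mt (i + j) 1) + e (.Mt (i + j) 2) + 2 • e (.M (i + j))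
  | .M i, .Mh k j _ => e (.Mh k (i + j) 0) + e (.Mh k (i + j) 1) + e (.Mh k (i + j) 2)
  | .Mh k i _, .M j => e (.Mh k (i + j) 0) + e (.Mh k (i + j) 1) + e (.Mh k (i + j) 2)
  | .Mt i ε, .Mh k j ε₁ => e (.Mh k (i + j) (kv k * ε + ε₁))
  | .Mh k j ε₁, .Mt i ε => e (.Mh k (i + j) (kv k * ε + ε₁))
  | .Mh k i ε, .Mh k' j ε₁ =>
      if k = k' then
        e (.Mh (1 - k) (i + j) (-(ε + ε₁))) + e (.Mh (1 - k) (i + j) (2 - (ε + ε₁)))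
      else if k = 0 then e (.Mt (i + j) (ε + 2 * ε₁)) + e (.M (i + j))
      else e (.Mt (i + j) (ε₁ + 2 * ε)) + e (.M (i + j))

/-- The multiplication of the fusion ring, extended `ℤ`-bilinearly from the basis products. -/
def rmul (x y : B20 → ℤ) : B20 → ℤ := fun z => ∑ a, ∑ b, x a * y b * bprod a b z

theorem rmul_add_left (x x' y : B20 → ℤ) : rmul (x + x') y = rmul x y + rmul x' y := by
  funext z
  simp only [rmul, Pi.add_apply, add_mul, Finset.sum_add_distrib]

theorem rmul_add_right (x y y' : B20 → ℤ) : rmul x (y + y') = rmul x y + rmul x y' := by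
  funext z
  simp only [rmul, Pi.add_apply, add_mul, mul_add, Finset.sum_add_distrib]

theorem rmul_smul_left (n : ℤ) (x y : B20 → ℤ) : rmul (n • x) y = n • rmul x y := by
  funext z
  simp only [rmul, Pi.smul_apply, smul_eq_mul, Finset.mul_sum, mul_assoc]

theorem rmul_smul_right (n : ℤ) (x y : B20 → ℤ) : rmul x (n • y) = n • rmul x y := by
  funext z
  simp only [rmul, Pi.smul_apply, smul_eq_mul, Finset.mul_sum, mul_assoc, mul_left_comm]

theorem rmul_basis (a b : B20) : rmul (e a) (e b) = bprod a b := by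
  funext z
  simp [rmul, e]

/-- To prove a linear property it suffices to check basis vectors. -/
theorem basis_induction {P : (B20 → ℤ) → Prop} (he : ∀ a, P (e a))
    (hadd : ∀ x y, P x → P y → P (x + y)) (hsmul : ∀ (n : ℤ) x, P x → P (n • x))
    (x : B20 → ℤ) : P x := by
  have hx : x = ∑ a, x a • e a := by
    funext z
    simp [e, Finset.sum_apply]
  have h0 : P 0 := by simpa using hsmul 0 _ (he (.M 0))
  rw [hx]
  exact Finset.sum_induction _ P hadd h0 (fun a _ => hsmul _ _ (he a))

theorem bprod_comm (a b : B20) : bprod a b = bprod b a := by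
  rcases a with ⟨i, p⟩ | i | ⟨k, i, p⟩ <;> rcases b with ⟨j, q⟩ | j | ⟨l, j, q⟩ <;>
    (try simp only [bprod, add_comm j i]) <;> (try rw [add_comm q p])
  fin_cases k <;> fin_cases l <;> simp

theorem one_bprod (a : B20) : bprod (.Mt 0 0) a = e a := by
  rcases a with ⟨i, p⟩ | i | ⟨k, i, p⟩ <;> simp [bprod]

theorem kv_zero : kv 0 = 1 := by decide

theorem kv_one : kv 1 = 2 := by decide

theorem zmod3_cases (p : ZMod 3) : p = 0 ∨ p = 1 ∨ p = 2 := by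
  revert p; decide

theorem fin2_cases (k : Fin 2) : k = 0 ∨ k = 1 := by
  revert k; decide

set_option linter.unusedSimpArgs false in
set_option maxHeartbeats 4000000 in
/-- Associativity on basis vectors. -/
theorem basis_assoc (a b c : B20) : rmul (bprod a b) (e c) = rmul (e a) (bprod b c) := by
  have h2 : (2 : ℕ) = 1 + 1 := rfl
  have n1 : (-1 : ZMod 3) = 2 := by decide
  have n2 : (-2 : ZMod 3) = 1 := by decide
  have s11 : (1 + 1 : ZMod 3) = 2 := by decide
  have s12 : (1 + 2 : ZMod 3) = 0 := by decide
  have s21 : (2 + 1 : ZMod 3) = 0 := by decide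
  have s22 : (2 + 2 : ZMod 3) = 1 := by decide
  have m22 : (2 * 2 : ZMod 3) = 1 := by decide
  have d21 : (2 - 1 : ZMod 3) = 1 := by decide
  have f10 : (1 : Fin 2) ≠ 0 := by decide
  have f01 : (0 : Fin 2) ≠ 1 := by decide
  have g : (1 - 0 : Fin 2) = 1 := by decide
  have g' : (1 - 1 : Fin 2) = 0 := by decide
  rcases a with ⟨i, p⟩ | i | ⟨k, i, p⟩ <;> rcases b with ⟨j, q⟩ | j | ⟨l, j, q⟩ <;>
    rcases c with ⟨t, r⟩ | t | ⟨m, t, r⟩ <;>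
    (try rcases fin2_cases k with rfl | rfl) <;>
    (try rcases fin2_cases l with rfl | rfl) <;>
    (try rcases fin2_cases m with rfl | rfl) <;>
    simp only [bprod, rmul_add_left, rmul_add_right, rmul_basis, h2, add_smul, one_smul,
      kv_zero, kv_one, if_true, if_false, f10, f01, g, g',
      show t + (i + j) = i + (j + t) by ring, show i + j + t = i + (j + t) by ring,
      show j + i = i + j by ring, show t + j = j + t by ring, show t + i = i + t by ring,
      show j + (i + t) = i + (j + t) by ring, show j + t + i = i + (j + t) by ring] <;>
    (try rcases zmod3_cases p with rfl | rfl | rfl) <;>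
    (try rcases zmod3_cases q with rfl | rfl | rfl) <;>
    (try rcases zmod3_cases r with rfl | rfl | rfl) <;>
    (try simp only [zero_add, add_zero, mul_zero, zero_mul, one_mul, mul_one, neg_zero, sub_zero,
      sub_self, n1, n2, s11, s12, s21, s22, m22, d21]) <;>
    (try abel)

/-- The multiplication on the fusion ring `R` of the `ℤ₃`-permutation orbifold of the rank-one
lattice vertex operator algebra `V_{ℤα}` (`⟨α,α⟩ = 2`) is associative, `M̃₀[0]` is a two-sided
multiplicative identity, and the multiplication is commutative; hence `R` is a commutative
associative unital ring. -/
theorem fusion_ring_is_comm_assoc_unital_ring :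
    (∀ x y z : B20 → ℤ, rmul (rmul x y) z = rmul x (rmul y z)) ∧
    (∀ x : B20 → ℤ, rmul (e (.Mt 0 0)) x = x ∧ rmul x (e (.Mt 0 0)) = x) ∧
    (∀ x y : B20 → ℤ, rmul x y = rmul y x) := by
  have hassoc : ∀ x y z : B20 → ℤ, rmul (rmul x y) z = rmul x (rmul y z) := by
    intro x y z
    induction x using basis_induction with
    | hadd x x' h h' => simp only [rmul_add_left, h, h']
    | hsmul n x h => simp only [rmul_smul_left, h]
    | he a =>
      induction y using basis_induction with
      | hadd x x' h h' => simp only [rmul_add_left, rmul_add_right, h, h']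
      | hsmul n x h => simp only [rmul_smul_left, rmul_smul_right, h]
      | he b =>
        induction z using basis_induction with
        | hadd x x' h h' => simp only [rmul_add_right, h, h']
        | hsmul n x h => simp only [rmul_smul_right, h]
        | he c => rw [rmul_basis, rmul_basis, basis_assoc]
  have hcomm : ∀ x y : B20 → ℤ, rmul x y = rmul y x := by
    intro x y
    induction x using basis_induction with
    | hadd x x' h h' => simp only [rmul_add_left, rmul_add_right, h, h']
    | hsmul n x h => simp only [rmul_smul_left, rmul_smul_right, h]
    | he a =>
      induction y using basis_induction with
      | hadd x x' h h' => simp only [rmul_add_left, rmul_add_right, h, h']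
      | hsmul n x h => simp only [rmul_smul_left, rmul_smul_right, h]
      | he b => rw [rmul_basis, rmul_basis, bprod_comm]
  have hone : ∀ x : B20 → ℤ, rmul (e (.Mt 0 0)) x = x := by
    intro x
    induction x using basis_induction with
    | hadd x x' h h' => simp only [rmul_add_right, h, h']
    | hsmul n x h => simp only [rmul_smul_right, h]
    | he a => rw [rmul_basis, one_bprod]
  exact ⟨hassoc, fun x => ⟨hone x, by rw [hcomm, hone]⟩, hcomm⟩
end

section
/- The ℤ-linear map q : R → ℤ defined on the basis by q(M̃_i[ε]) = 1, q(M̂_{k,i}[ε]) = 2, and q(M^i) = 3 is a ring homomorphism, i.e. q(x·y) = q(x)·q(y) for all x, y ∈ R and q(M̃₀[0]) = 1. (These values are the quantum dimensions of the irreducible modules of the orbifold vertex operator algebra.) -/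
open scoped BigOperators

/-- Quantum dimensions of the irreducible modules. -/
def qd : B20 → ℤ
  | .Mt _ _ => 1
  | .Mh _ _ _ => 2
  | .M _ => 3

/-- The `ℤ`-linear extension of the quantum dimension function to the fusion ring. -/
def q (x : B20 → ℤ) : ℤ := ∑ a, x a * qd a

theorem q_e (z : B20) : q (e z) = qd z := by
  simp [q, e]

theorem q_add (x y : B20 → ℤ) : q (x + y) = q x + q y := by
  simp [q, add_mul, Finset.sum_add_distrib]

theorem q_bprod (a b : B20) : q (bprod a b) = qd a * qd b := by
  rcases a with ⟨i, s⟩ | i | ⟨k, i, s⟩ <;> rcases b with ⟨j, t⟩ | j | ⟨l, j, t⟩ <;>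
    simp only [bprod, two_smul] <;> (try split_ifs) <;> simp only [q_add, q_e, qd] <;> norm_num

/-- The `ℤ`-linear map `q` sending `M̃_i[ε] ↦ 1`, `M̂_{k,i}[ε] ↦ 2`, `M^i ↦ 3` (the quantum
dimensions of the irreducible modules of the orbifold vertex operator algebra) is a ring
homomorphism from the fusion ring to `ℤ`. -/
theorem quantum_dimension_is_ring_hom :
    (∀ x y : B20 → ℤ, q (rmul x y) = q x * q y) ∧ q (e (.Mt 0 0)) = 1 := by
  refine ⟨fun x y => ?_, q_e _⟩
  have h : q (rmul x y) = ∑ a, ∑ b, x a * y b * q (bprod a b) := by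
    simp only [q, rmul, Finset.sum_mul, Finset.mul_sum]
    rw [Finset.sum_comm]
    refine Finset.sum_congr rfl fun a _ => ?_
    rw [Finset.sum_comm]
    refine Finset.sum_congr rfl fun b _ => Finset.sum_congr rfl fun z _ => ?_
    ring
  rw [h, q, q, Finset.sum_mul_sum]
  refine Finset.sum_congr rfl fun a _ => Finset.sum_congr rfl fun b _ => ?_
  rw [q_bprod]
  ring
end

section
/- The 20×20 complex matrix S is symmetric: S_{x,y} = S_{y,x} for all basis elements x, y of R. -/
open scoped BigOperators

/-- The contragredient involution on the 20 basis elements. -/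
def dual : B20 → B20
  | .Mt i ε => .Mt i (-ε)
  | .M i => .M i
  | .Mh k i ε => .Mh (1 - k) i ε

/-- Conformal weights of the irreducible modules. -/
def cw : B20 → ℚ
  | .Mt i ε => if i = 0 then (if ε = 0 then 0 else 1) else 3/4
  | .M i => if i = 0 then 1/2 else 1/4
  | .Mh _ i ε =>
      if i = 0 then (if ε = 0 then 1/9 else if ε = 1 then 7/9 else 4/9)
      else (if ε = 0 then 31/36 else if ε = 1 then 19/36 else 7/36)

/-- `θ_x = exp(2πi·Δ(x))`. -/
noncomputable def th (x : B20) : ℂ := Complex.exp (2 * Real.pi * Complex.I * (cw x : ℂ))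

/-- The `S`-matrix of the orbifold vertex operator algebra
`(V_{ℤα} ⊗ V_{ℤα} ⊗ V_{ℤα})^{ℤ₃}`:
`S_{x,y} = (1/(6√2)) · Σ_z N^z_{x′,y} · (θ_z/(θ_xθ_y)) · d(z)`. -/
noncomputable def S (x y : B20) : ℂ :=
  (1 / (6 * Real.sqrt 2)) *
    ∑ z, (bprod (dual x) y z : ℂ) * (th z / (th x * th y)) * (qd z : ℂ)

/-- The contragredient map is an involution. -/
theorem dual_dual_B20 (x : B20) : dual (dual x) = x := by
  revert x; decide

/-- Fusion commutes with the contragredient involution (together with commutativity). -/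
theorem bprod_dual_symm :
    ∀ x y z : B20, bprod (dual x) y z = bprod (dual y) x (dual z) := by
  decide +kernel

theorem cw_dual : ∀ z : B20, cw (dual z) = cw z := by
  decide +kernel

theorem qd_dual : ∀ z : B20, qd (dual z) = qd z := by
  decide

theorem th_dual (z : B20) : th (dual z) = th z := by
  simp only [th, cw_dual]

/-- The `20×20` complex `S`-matrix of the orbifold vertex operator algebra is symmetric. -/
theorem S_matrix_symmetric : ∀ x y : B20, S x y = S y x := by
  intro x y
  unfold S
  congr 1
  refine Fintype.sum_equiv ⟨dual, dual, dual_dual_B20, dual_dual_B20⟩ _ _ fun z => ?_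
  simp only [Equiv.coe_fn_mk]
  rw [bprod_dual_symm x y z, th_dual, qd_dual, mul_comm (th x)]
end

section
/- The 20×20 complex matrix S is unitary: S multiplied by its conjugate transpose is the identity matrix, i.e. Σ_w S_{x,w}·conj(S_{y,w}) = δ_{x,y} for all basis elements x, y of R. -/
open scoped BigOperators

/-- The list of the 20 basis elements. -/
def els : List B20 :=
  [.M 0, .M 1] ++
  (do let i ← [(0 : ZMod 2), 1]; let ε ← [(0 : ZMod 3), 1, 2]; [B20.Mt i ε]) ++
  (do let k ← [(0 : Fin 2), 1]; let i ← [(0 : ZMod 2), 1]; let ε ← [(0 : ZMod 3), 1, 2]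
      [B20.Mh k i ε])

theorem els_nodup : els.Nodup := by decide +kernel

theorem mem_els : ∀ x : B20, x ∈ els := by decide +kernel

theorem sum_els (f : B20 → ℂ) : ∑ z, f z = (els.map f).sum := by
  rw [← List.sum_toFinset f els_nodup]
  congr 1
  ext x
  simp [mem_els]

/-- A primitive 36-th root of unity. -/
noncomputable def zt : ℂ := Complex.exp (2 * Real.pi * Complex.I / 36)

theorem zt_prim : IsPrimitiveRoot zt 36 := by
  have := Complex.isPrimitiveRoot_exp 36 (by norm_num)
  simpa [zt] using this

theorem zt_36 : zt ^ 36 = 1 := zt_prim.pow_eq_one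

theorem zt_ne : zt ≠ 0 := Complex.exp_ne_zero _

theorem zt_18 : zt ^ 18 = -1 := by
  have h : (zt ^ 18 - 1) * (zt ^ 18 + 1) = 0 := by linear_combination zt_36
  rcases mul_eq_zero.1 h with h | h
  · exact absurd (sub_eq_zero.1 h) (zt_prim.pow_ne_one_of_pos_of_lt (by norm_num) (by norm_num))
  · linear_combination h

theorem zt_12 : zt ^ 12 = zt ^ 6 - 1 := by
  have h : (zt ^ 6 + 1) * (zt ^ 12 - zt ^ 6 + 1) = 0 := by linear_combination zt_18
  rcases mul_eq_zero.1 h with h | h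
  · refine absurd ?_ (zt_prim.pow_ne_one_of_pos_of_lt (l := 12) (by norm_num) (by norm_num))
    linear_combination (zt ^ 6 - 1) * h
  · linear_combination h

theorem zt_conj : (starRingEnd ℂ) zt = zt ^ 35 := by
  have h1 : (starRingEnd ℂ) zt * zt = 1 := by
    rw [zt, ← Complex.exp_conj, ← Complex.exp_add]
    rw [Complex.exp_eq_one_iff]
    refine ⟨0, ?_⟩
    simp only [map_mul, map_div₀, Complex.conj_ofReal, Complex.conj_I, map_ofNat]
    push_cast
    ring
  have h2 : zt ^ 35 * zt = 1 := by rw [← pow_succ]; exact zt_36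
  exact mul_right_cancel₀ zt_ne (h1.trans h2.symm)

/-- Evaluation of a formal sum of terms `c·ζ^e`. -/
noncomputable def ev : List (ℤ × ℕ) → ℂ
  | [] => 0
  | p :: L => (p.1 : ℂ) * zt ^ p.2 + ev L

/-- The coefficient of `ζ^r`, `0 ≤ r < 36`. -/
def cf : List (ℤ × ℕ) → ℕ → ℤ
  | [], _ => 0
  | p :: L, r => bif Nat.beq (p.2 % 36) r then Int.add p.1 (cf L r) else cf L r

/-- Vanishing test modulo the cyclotomic polynomial `X^12 - X^6 + 1`. -/
def chk (L : List (ℤ × ℕ)) : Bool :=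
  [0, 1, 2, 3, 4, 5].all fun r =>
    (cf L r + cf L (r + 30) == cf L (r + 12) + cf L (r + 18)) &&
    (cf L (r + 6) + cf L (r + 12) == cf L (r + 24) + cf L (r + 30))

theorem zt_mod (n : ℕ) : zt ^ n = zt ^ (n % 36) := by
  conv_lhs => rw [← Nat.mod_add_div n 36, pow_add, pow_mul, zt_36, one_pow, mul_one]

theorem ev_eq (L : List (ℤ × ℕ)) : ev L = ∑ r ∈ Finset.range 36, (cf L r : ℂ) * zt ^ r := by
  induction L with
  | nil => simp [ev, cf]
  | cons p L ih =>
    have hp : p.2 % 36 < 36 := Nat.mod_lt _ (by norm_num)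
    have hcf : ∀ r, cf (p :: L) r = (if p.2 % 36 = r then p.1 else 0) + cf L r := by
      intro r
      by_cases hr : p.2 % 36 = r
      · have : Nat.beq (p.2 % 36) r = true := Nat.beq_eq ▸ hr
        rw [cf, this, if_pos hr]; rfl
      · have : Nat.beq (p.2 % 36) r = false := by
          rw [← Bool.not_eq_true, Nat.beq_eq]; exact hr
        rw [cf, this, if_neg hr, zero_add]; rfl
    simp only [ev, hcf, ih, Int.cast_add, add_mul, Finset.sum_add_distrib]
    congr 1
    rw [Finset.sum_eq_single (p.2 % 36)]
    · rw [if_pos rfl, ← zt_mod]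
    · intro b _ hb
      rw [if_neg (Ne.symm hb)]; simp
    · intro h
      exact absurd (Finset.mem_range.2 hp) h

theorem ev_zero (L : List (ℤ × ℕ)) (h : chk L = true) : ev L = 0 := by
  have key : ∀ r, cf L r + cf L (r + 30) = cf L (r + 12) + cf L (r + 18) →
      cf L (r + 6) + cf L (r + 12) = cf L (r + 24) + cf L (r + 30) →
      ∑ k ∈ Finset.range 6, (cf L (r + 6 * k) : ℂ) * zt ^ (r + 6 * k) = 0 := by
    intro r h1 h2
    have h1' : (cf L r + cf L (r + 30) : ℂ) = cf L (r + 12) + cf L (r + 18) := by exact_mod_cast h1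
    have h2' : (cf L (r + 6) + cf L (r + 12) : ℂ) = cf L (r + 24) + cf L (r + 30) := by
      exact_mod_cast h2
    have h3 := zt_12
    have e2 : zt ^ (6 * 2) = zt ^ 6 - 1 := zt_12
    have e3 : zt ^ (6 * 3) = -1 := zt_18
    have e4 : zt ^ (6 * 4) = -zt ^ 6 := by linear_combination zt ^ 6 * zt_18
    have e5 : zt ^ (6 * 5) = 1 - zt ^ 6 := by linear_combination zt ^ 12 * zt_18 - zt_12
    simp only [pow_add, Finset.sum_range_succ, Finset.sum_range_zero, e2, e3, e4, e5]
    norm_num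
    linear_combination zt ^ r * h1' + zt ^ r * zt ^ 6 * h2'
  simp only [chk, List.all_cons, List.all_nil, Bool.and_true, Bool.and_eq_true, beq_iff_eq] at h
  obtain ⟨⟨a0, b0⟩, ⟨a1, b1⟩, ⟨a2, b2⟩, ⟨a3, b3⟩, ⟨a4, b4⟩, ⟨a5, b5⟩⟩ := h
  have k0 := key 0 a0 b0
  have k1 := key 1 a1 b1
  have k2 := key 2 a2 b2
  have k3 := key 3 a3 b3
  have k4 := key 4 a4 b4
  have k5 := key 5 a5 b5
  rw [ev_eq]
  simp only [Finset.sum_range_succ, Finset.sum_range_zero, Nat.reduceMul, Nat.reduceAdd]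
    at k0 k1 k2 k3 k4 k5 ⊢
  linear_combination k0 + k1 + k2 + k3 + k4 + k5

theorem ev_append (L K : List (ℤ × ℕ)) : ev (L ++ K) = ev L + ev K := by
  induction L with
  | nil => simp [ev]
  | cons p L ih => simp [ev, ih, add_assoc]

theorem ev_map (l : List B20) (g : B20 → ℤ × ℕ) :
    ev (l.map g) = (l.map fun w => ((g w).1 : ℂ) * zt ^ (g w).2).sum := by
  induction l with
  | nil => simp [ev]
  | cons p L ih => simp [ev, ih]

/-- `36·Δ`. -/
def E36 : B20 → ℕ
  | .Mt i ε => if i = 0 then (if ε = 0 then 0 else 36) else 27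
  | .M i => if i = 0 then 18 else 9
  | .Mh _ i ε =>
      if i = 0 then (if ε = 0 then 4 else if ε = 1 then 28 else 16)
      else (if ε = 0 then 31 else if ε = 1 then 19 else 7)

theorem cw_E36 : ∀ x, cw x = (E36 x : ℚ) / 36 := by
  intro x
  rcases x with ⟨i, ε⟩ | i | ⟨k, i, ε⟩ <;> simp only [cw, E36] <;> split_ifs <;> norm_num

theorem E36_le : ∀ x, E36 x ≤ 36 := by decide +kernel

theorem th_eq (x : B20) : th x = zt ^ E36 x := by
  rw [th, cw_E36, zt, ← Complex.exp_nat_mul]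
  congr 1
  push_cast
  ring

theorem th_inv (x : B20) : (th x)⁻¹ = zt ^ (36 - E36 x) := by
  rw [th_eq]
  refine inv_eq_of_mul_eq_one_right ?_
  rw [← pow_add, Nat.add_sub_cancel' (E36_le x), zt_36]

/-- Every entry of `6√2·S` is an integer times a power of `ζ`; this gives both. -/
def mono : B20 → B20 → ℤ × ℕ
  | .Mt i _, .Mt j _ => (1, 18 * (i.val * j.val))
  | .Mt i _, .M j => (3, 18 * (i.val * j.val))
  | .M i, .Mt j _ => (3, 18 * (i.val * j.val))
  | .M i, .M j => (-3, 18 * (i.val * j.val))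
  | .M _, .Mh _ _ _ => (0, 0)
  | .Mh _ _ _, .M _ => (0, 0)
  | .Mt i ε, .Mh k j _ => (2, 18 * (i.val * j.val) + 12 * ((k.val + 1) * ε.val))
  | .Mh k j _, .Mt i ε => (2, 18 * (i.val * j.val) + 12 * ((k.val + 1) * ε.val))
  | .Mh k i ε, .Mh k' j ε₁ =>
      if k = k' then (2, 18 * (i.val * j.val) + 10 + 12 * (ε.val + ε₁.val))
      else (2, 18 * (i.val * j.val) + 2 + 24 * (ε.val + ε₁.val))

/-- The formal sum defining `6√2·S`. -/
def raw (x y : B20) : List (ℤ × ℕ) :=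
  els.map fun z => (bprod (dual x) y z * qd z, E36 z + (36 - E36 x) + (36 - E36 y))

theorem raw_chk : ∀ x y, chk ((-(mono x y).1, (mono x y).2) :: raw x y) = true := by
  decide +kernel

theorem S_eq (x y : B20) :
    S x y = (1 / (6 * Real.sqrt 2)) * (((mono x y).1 : ℂ) * zt ^ (mono x y).2) := by
  have h := ev_zero _ (raw_chk x y)
  rw [S, sum_els]
  congr 1
  simp only [ev, raw, ev_map] at h
  push_cast at h
  rw [← sub_eq_zero, ← h]
  have : ∀ z, (bprod (dual x) y z : ℂ) * (th z / (th x * th y)) * (qd z : ℂ) =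
      (bprod (dual x) y z : ℂ) * qd z * zt ^ (E36 z + (36 - E36 x) + (36 - E36 y)) := by
    intro z
    rw [div_eq_mul_inv, mul_inv, th_inv, th_inv, th_eq, pow_add, pow_add]
    ring
  simp only [this]
  ring

/-- The formal sum for the `(x,y)` entry of `72·S·S*`. -/
def gram (x y : B20) : List (ℤ × ℕ) :=
  els.map fun w => ((mono x w).1 * (mono y w).1, (mono x w).2 + 35 * (mono y w).2)

theorem gram_chk : ∀ x y, chk ((if x = y then -72 else 0, 0) :: gram x y) = true := by
  decide +kernel

/-- The `S`-matrix is unitary: `Σ_w S_{x,w}·conj(S_{y,w}) = δ_{x,y}`. -/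
theorem S_matrix_unitary :
    ∀ x y : B20, (∑ w, S x w * (starRingEnd ℂ) (S y w)) = if x = y then 1 else 0 := by
  intro x y
  have h := ev_zero _ (gram_chk x y)
  simp only [ev, gram, ev_map, pow_zero, mul_one] at h
  have hs : ((Real.sqrt 2 : ℝ) : ℂ) ^ 2 = 2 := by
    rw [← Complex.ofReal_pow, Real.sq_sqrt (by norm_num)]; norm_num
  have hs0 : ((Real.sqrt 2 : ℝ) : ℂ) ≠ 0 := by
    intro h0; rw [h0] at hs; norm_num at hs
  have hc : (1 / (6 * ((Real.sqrt 2 : ℝ) : ℂ))) * (1 / (6 * ((Real.sqrt 2 : ℝ) : ℂ))) = 1 / 72 := by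
    rw [div_mul_div_comm]
    congr 1
    · norm_num
    · linear_combination 36 * hs
  have key : ∀ w, S x w * (starRingEnd ℂ) (S y w) = (1 / 72 : ℂ) *
      ((((mono x w).1 * (mono y w).1 : ℤ) : ℂ) * zt ^ ((mono x w).2 + 35 * (mono y w).2)) := by
    intro w
    rw [S_eq, S_eq, ← hc]
    simp only [map_mul, map_div₀, map_pow, zt_conj, map_one, Complex.conj_ofReal, map_intCast,
      map_ofNat, pow_add, pow_mul]
    push_cast
    ring
  rw [Finset.sum_congr rfl fun w _ => key w, ← Finset.mul_sum, sum_els]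
  split_ifs at h ⊢ with hxy
  · push_cast at h ⊢
    linear_combination (1 / 72 : ℂ) * h
  · push_cast at h ⊢
    linear_combination (1 / 72 : ℂ) * h
end
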